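/- MAX SMTI-1TM admits a man-strategy-proof 1.5-approximate-stable mechanism: there exists a mechanism S on SMTI-1TM instances such that for every instance I, S(I) is a stable matching with 3·|S(I)| ≥ 2·|M_opt| for every stable matching M_opt of I, and no man can, by submitting a falsified preference list while all other lists are unchanged, obtain an outcome he prefers with respect to his true list. -/

import Mathlib

/-- An instance of the stable marriage problem with ties and incomplete lists (SMTI),
with men of type `α` and women of type `β`.  Each person's preference list is
represented by a rank function: `mpref m w = none` means woman `w` is unacceptable
to man `m`, and `mpref m w = some r` means `w` is acceptable with rank `r`
(smaller rank = more preferred; equal ranks = a tie).  This encodes exactly a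
total preorder on the set of acceptable partners. -/
structure SMInst (α β : Type) where
  mpref : α → β → Option ℕ
  wpref : β → α → Option ℕ

namespace SMInst

variable {α β : Type}

/-- Woman `w` is acceptable to man `m`. -/
def mAcc (I : SMInst α β) (m : α) (w : β) : Prop := (I.mpref m w).isSome

/-- Man `m` is acceptable to woman `w`. -/
def wAcc (I : SMInst α β) (w : β) (m : α) : Prop := (I.wpref w m).isSome

/-- Man `m` strictly prefers woman `w` to woman `w'`. -/
def mPref (I : SMInst α β) (m : α) (w w' : β) : Prop :=
  ∃ r r', I.mpref m w = some r ∧ I.mpref m w' = some r' ∧ r < r'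

/-- Woman `w` strictly prefers man `m` to man `m'`. -/
def wPref (I : SMInst α β) (w : β) (m m' : α) : Prop :=
  ∃ r r', I.wpref w m = some r ∧ I.wpref w m' = some r' ∧ r < r'

/-- `M` is a matching of `I`: all pairs mutually acceptable and no person in two pairs. -/
def IsMatching (I : SMInst α β) (M : Finset (α × β)) : Prop :=
  (∀ p ∈ M, I.mAcc p.1 p.2 ∧ I.wAcc p.2 p.1) ∧
  (∀ p ∈ M, ∀ q ∈ M, p.1 = q.1 → p = q) ∧
  (∀ p ∈ M, ∀ q ∈ M, p.2 = q.2 → p = q)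

/-- Man `m` is single (unmatched) in `M`. -/
def mSingle (M : Finset (α × β)) (m : α) : Prop := ∀ w, (m, w) ∉ M

/-- Woman `w` is single (unmatched) in `M`. -/
def wSingle (M : Finset (α × β)) (w : β) : Prop := ∀ m, (m, w) ∉ M

/-- `(m, w)` blocks `M` in instance `I`. -/
def Blocks (I : SMInst α β) (M : Finset (α × β)) (m : α) (w : β) : Prop :=
  I.mAcc m w ∧ I.wAcc w m ∧
  (mSingle M m ∨ ∃ w', (m, w') ∈ M ∧ I.mPref m w w') ∧
  (wSingle M w ∨ ∃ m', (m', w) ∈ M ∧ I.wPref w m m')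

/-- `M` is a (weakly) stable matching of `I`. -/
def IsStable (I : SMInst α β) (M : Finset (α × β)) : Prop :=
  I.IsMatching M ∧ ∀ m w, ¬ I.Blocks M m w

/-- Man `m` prefers matching `M'` to matching `M`, with respect to his list in `I`:
he is matched in `M'` to an acceptable partner, and he is either single in `M`
or strictly prefers his `M'`-partner to his `M`-partner. -/
def mPrefMatching (I : SMInst α β) (m : α) (M' M : Finset (α × β)) : Prop :=
  ∃ w, (m, w) ∈ M' ∧ I.mAcc m w ∧
    (mSingle M m ∨ ∃ w', (m, w') ∈ M ∧ I.mPref m w w')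

/-- Woman `w` prefers matching `M'` to matching `M`, with respect to her list in `I`. -/
def wPrefMatching (I : SMInst α β) (w : β) (M' M : Finset (α × β)) : Prop :=
  ∃ m, (m, w) ∈ M' ∧ I.wAcc w m ∧
    (wSingle M w ∨ ∃ m', (m', w) ∈ M ∧ I.wPref w m m')

/-- `I` and `I'` differ only in man `m`'s preference list. -/
def mDiffOnly (I I' : SMInst α β) (m : α) : Prop :=
  I.wpref = I'.wpref ∧ ∀ m', m' ≠ m → I.mpref m' = I'.mpref m'

/-- `I` and `I'` differ only in woman `w`'s preference list. -/
def wDiffOnly (I I' : SMInst α β) (w : β) : Prop :=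
  I.mpref = I'.mpref ∧ ∀ w', w' ≠ w → I.wpref w' = I'.wpref w'

/-- Men's lists contain no ties. -/
def MStrict (I : SMInst α β) : Prop :=
  ∀ m w w', I.mpref m w = I.mpref m w' → I.mAcc m w → w = w'

/-- Women's lists contain no ties. -/
def WStrict (I : SMInst α β) : Prop :=
  ∀ w m m', I.wpref w m = I.wpref w m' → I.wAcc w m → m = m'

/-- `I` is an SMI instance: no ties at all (all lists strictly ordered). -/
def NoTies (I : SMInst α β) : Prop := I.MStrict ∧ I.WStrict

/-- `I` is an SMTI-1TM instance: ties may occur only in men's lists,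
i.e. women's lists are strictly ordered. -/
def OneTM (I : SMInst α β) : Prop := I.WStrict

/-- `I'` is obtained from `I` by breaking ties: same acceptable sets, and every
strict preference of `I` is preserved in `I'` (so each person's list in `I'` is a
linear extension of the corresponding total preorder in `I`). -/
def Refines (I I' : SMInst α β) : Prop :=
  (∀ m w, I.mAcc m w ↔ I'.mAcc m w) ∧
  (∀ w m, I.wAcc w m ↔ I'.wAcc w m) ∧
  (∀ m w w', I.mPref m w w' → I'.mPref m w w') ∧
  (∀ w m m', I.wPref w m m' → I'.wPref w m m')

end SMInst

/-- A two-sided market with contracts: each contract names a man and a woman, and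
smaller keys `mkey`, `wkey` are better for the man and for the woman respectively.
Each person's keys are injective on the contracts naming that person. -/
structure ContractMarket (C α β K L : Type*) where
  man : C → α
  woman : C → β
  acc : Set C
  mkey : C → K
  wkey : C → L
  mkey_inj : ∀ c d, man c = man d → mkey c = mkey d → c = d
  wkey_inj : ∀ c d, woman c = woman d → wkey c = wkey d → c = d

namespace ContractMarket

variable {C α β K L : Type*} [LinearOrder K] [LinearOrder L]

/-- A stable set of acceptable contracts: each person signs at most one, and every
acceptable contract is weakly dominated for its man or for its woman. -/
structure Stable (X : ContractMarket C α β K L) (s : Set C) : Prop where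
  subset_acc : s ⊆ X.acc
  man_inj : ∀ c ∈ s, ∀ d ∈ s, X.man c = X.man d → c = d
  woman_inj : ∀ c ∈ s, ∀ d ∈ s, X.woman c = X.woman d → c = d
  dom : ∀ d ∈ X.acc, (∃ e ∈ s, X.man e = X.man d ∧ X.mkey e ≤ X.mkey d) ∨
    (∃ e ∈ s, X.woman e = X.woman d ∧ X.wkey e ≤ X.wkey d)

/-- A stable set that every man weakly prefers to every other stable set. -/
def ManOptimal (X : ContractMarket C α β K L) (s : Set C) : Prop :=
  X.Stable s ∧ ∀ t, X.Stable t →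
    ∀ c ∈ t, ∃ e ∈ s, X.man e = X.man c ∧ X.mkey e ≤ X.mkey c

/-- The contracts that men propose once those in `R` have been rejected. -/
def offered (X : ContractMarket C α β K L) (R : Set C) : Set C :=
  {c ∈ X.acc | ∀ d ∈ X.acc, X.man d = X.man c → X.mkey d < X.mkey c → d ∈ R}

/-- The contracts that women reject in favour of a better offer, given the previously
rejected ones. -/
def reject (X : ContractMarket C α β K L) : Set C →o Set C where
  toFun R := {c ∈ X.acc | ∃ e ∈ X.offered R, X.woman e = X.woman c ∧ X.wkey e < X.wkey c}
  monotone' := by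
    rintro R T h c ⟨hc, e, ⟨he, hR⟩, hw⟩
    exact ⟨hc, e, ⟨he, fun d hd hm hk => h (hR d hd hm hk)⟩, hw⟩

theorem exists_manOptimal [Finite C] (X : ContractMarket C α β K L) :
    ∃ s, X.ManOptimal s := by
  set R := X.reject.lfp
  have hR : X.reject R = R := X.reject.map_lfp
  have key : ∀ d ∈ X.acc, d ∉ R →
      ∃ e ∈ X.offered R \ R, X.man e = X.man d ∧ X.mkey e ≤ X.mkey d := by
    intro d hd hdR
    obtain ⟨e, ⟨he, heR, hem⟩, hmin⟩ := Set.exists_min_image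
      {e | e ∈ X.acc ∧ e ∉ R ∧ X.man e = X.man d} X.mkey (Set.toFinite _) ⟨d, hd, hdR, rfl⟩
    refine ⟨e, ⟨⟨he, fun f hf hfm hlt => ?_⟩, heR⟩, hem, hmin d ⟨hd, hdR, rfl⟩⟩
    by_contra hfR
    exact absurd (hmin f ⟨hf, hfR, hfm.trans hem⟩) (not_le.2 hlt)
  refine ⟨X.offered R \ R, ⟨fun c hc => hc.1.1, ?_, ?_, ?_⟩, ?_⟩
  · intro c hc d hd hm
    rcases lt_trichotomy (X.mkey c) (X.mkey d) with h | h | h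
    · exact absurd (hd.1.2 c hc.1.1 hm h) hc.2
    · exact X.mkey_inj c d hm h
    · exact absurd (hc.1.2 d hd.1.1 hm.symm h) hd.2
  · intro c hc d hd hw
    rcases lt_trichotomy (X.wkey c) (X.wkey d) with h | h | h
    · exact absurd (hR ▸ (⟨hd.1.1, c, hc.1, hw, h⟩ : d ∈ X.reject R)) hd.2
    · exact X.wkey_inj c d hw h
    · exact absurd (hR ▸ (⟨hc.1.1, d, hd.1, hw.symm, h⟩ : c ∈ X.reject R)) hc.2
  · intro d hd
    by_cases hdR : d ∈ R
    · right
      obtain ⟨-, e, he, hew, hlt⟩ : d ∈ X.reject R := hR.symm ▸ hdR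
      obtain ⟨f, ⟨hf, hfw⟩, hmin⟩ := Set.exists_min_image
        {f | f ∈ X.offered R ∧ X.woman f = X.woman d} X.wkey (Set.toFinite _) ⟨e, he, hew⟩
      refine ⟨f, ⟨hf, fun hfR => ?_⟩, hfw, (hmin e ⟨he, hew⟩).trans hlt.le⟩
      obtain ⟨-, g, hg, hgw, hglt⟩ : f ∈ X.reject R := hR.symm ▸ hfR
      exact absurd (hmin g ⟨hg, hgw.trans hfw⟩) (not_le.2 hglt)
    · exact Or.inl (key d hd hdR)
  · intro t ht c hc
    refine key c (ht.subset_acc hc) fun hcR => ?_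
    have hle : R ≤ tᶜ := by
      refine X.reject.lfp_le ?_
      rintro c ⟨-, e, ⟨he, hbest⟩, hew, hlt⟩ hct
      rcases ht.dom e he with ⟨f, hf, hfm, hfk⟩ | ⟨f, hf, hfw, hfk⟩
      · rcases hfk.lt_or_eq with h | h
        · exact hbest f (ht.subset_acc hf) hfm h hf
        · obtain rfl := X.mkey_inj _ _ hfm h
          obtain rfl := ht.woman_inj _ hf _ hct hew
          exact lt_irrefl _ hlt
      · obtain rfl := ht.woman_inj _ hf _ hct (hfw.trans hew)
        exact absurd hfk (not_le.2 hlt)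
    exact hle hcR hc

/-- A man who signs a contract in some stable set also signs one in any other. -/
theorem Stable.exists_man_eq [Finite C] {X : ContractMarket C α β K L} {s t : Set C}
    (hs : X.Stable s) (ht : X.Stable t) {c : C} (hc : c ∈ s) :
    ∃ d ∈ t, X.man d = X.man c := by
  obtain ⟨o, ho, hopt⟩ := X.exists_manOptimal
  have hwom : X.woman '' o ⊆ X.woman '' t := by
    rintro _ ⟨e, he, rfl⟩
    rcases ht.dom e (ho.subset_acc he) with ⟨f, hf, hfm, hfk⟩ | ⟨f, hf, hfw, -⟩
    · obtain ⟨g, hg, hgm, hgk⟩ := hopt t ht f hf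
      obtain rfl := ho.man_inj _ hg _ he (hgm.trans hfm)
      obtain rfl := X.mkey_inj _ _ hfm (le_antisymm hfk hgk)
      exact ⟨f, hf, rfl⟩
    · exact ⟨f, hf, hfw⟩
  have hman : X.man '' t ⊆ X.man '' o := by
    rintro _ ⟨e, he, rfl⟩
    obtain ⟨g, hg, hgm, -⟩ := hopt t ht e he
    exact ⟨g, hg, hgm⟩
  have hcard : (X.man '' o).ncard ≤ (X.man '' t).ncard := by
    rw [Set.InjOn.ncard_image fun a ha b hb h => ho.man_inj a ha b hb h,
      Set.InjOn.ncard_image fun a ha b hb h => ht.man_inj a ha b hb h,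
      ← Set.InjOn.ncard_image fun a ha b hb h => ho.woman_inj a ha b hb h,
      ← Set.InjOn.ncard_image fun a ha b hb h => ht.woman_inj a ha b hb h]
    exact Set.ncard_le_ncard hwom (Set.toFinite _)
  have heq := Set.eq_of_subset_of_ncard_le hman hcard (Set.toFinite _)
  obtain ⟨g, hg, hgm, -⟩ := hopt s hs c hc
  have hmem : X.man g ∈ X.man '' t := heq ▸ Set.mem_image_of_mem X.man hg
  rwa [hgm] at hmem

/-- The market in which the contracts of `X` outside `s` have become unacceptable. -/
def restrict (X : ContractMarket C α β K L) (s : Set C) : ContractMarket C α β K L :=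
  { X with acc := X.acc ∩ s }

/-- If two markets differ only in the preferences of a man `m`, then the man-optimal
stable set of the first gives `m` a contract at least as good as any contract acceptable to
him that he signs in a stable set of the second. -/
theorem ManOptimal.exists_mkey_le [Finite C] {X Y : ContractMarket C α β K L} {s t : Set C}
    (m : α) (hman : Y.man = X.man) (hwoman : Y.woman = X.woman) (hwkey : Y.wkey = X.wkey)
    (hacc : ∀ c, X.man c ≠ m → (c ∈ Y.acc ↔ c ∈ X.acc))
    (hmkey : ∀ c, X.man c ≠ m → Y.mkey c = X.mkey c)
    (hs : X.ManOptimal s) (ht : Y.Stable t) {c : C} (hct : c ∈ t) (hcX : c ∈ X.acc)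
    (hcm : X.man c = m) : ∃ e ∈ s, X.man e = m ∧ X.mkey e ≤ X.mkey c := by
  by_contra! hno
  have hsep : ∀ d ∈ t, X.man d = m → d = c := fun d hd hdm =>
    ht.man_inj d hd c hct (by rw [hman, hdm, hcm])
  have htZ : (X.restrict {d | X.man d = m → d = c}).Stable t := by
    refine ⟨fun d hd => ⟨?_, hsep d hd⟩, fun a ha b hb h => ht.man_inj a ha b hb ?_,
      fun a ha b hb h => ht.woman_inj a ha b hb ?_, ?_⟩
    · by_cases hdm : X.man d = m
      · exact hsep d hd hdm ▸ hcX
      · exact (hacc d hdm).1 (ht.subset_acc hd)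
    · rw [hman]; exact h
    · rw [hwoman]; exact h
    · rintro d ⟨hd, hdc⟩
      by_cases hdm : X.man d = m
      · obtain rfl := hdc hdm
        exact Or.inl ⟨d, hct, rfl, le_rfl⟩
      · rcases ht.dom d ((hacc d hdm).2 hd) with ⟨e, he, hem, hek⟩ | ⟨e, he, hew, hek⟩
        · rw [hman] at hem
          rw [hmkey d hdm, hmkey e (hem ▸ hdm)] at hek
          exact Or.inl ⟨e, he, hem, hek⟩
        · rw [hwoman] at hew
          rw [hwkey] at hek
          exact Or.inr ⟨e, he, hew, hek⟩
  obtain ⟨r, hr, -⟩ :=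
    (X.restrict {d | X.man d = m → X.mkey d ≤ X.mkey c}).exists_manOptimal
  have hrm : ∀ d ∈ r, X.man d ≠ m := by
    intro d hd hdm
    have hrX : X.Stable r := by
      refine ⟨fun a ha => (hr.subset_acc ha).1, hr.man_inj, hr.woman_inj, fun a ha => ?_⟩
      by_cases hcase : X.man a = m → X.mkey a ≤ X.mkey c
      · exact hr.dom a ⟨ha, hcase⟩
      · push Not at hcase
        exact Or.inl ⟨d, hd, hdm.trans hcase.1.symm,
          ((hr.subset_acc hd).2 hdm).trans hcase.2.le⟩
    obtain ⟨e, he, hem, hek⟩ := hs.2 r hrX d hd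
    exact absurd (hek.trans ((hr.subset_acc hd).2 hdm)) (not_le.2 (hno e he (hem.trans hdm)))
  have hrZ : (X.restrict {d | X.man d = m → d = c}).Stable r := by
    refine ⟨fun d hd => ⟨(hr.subset_acc hd).1, fun h => absurd h (hrm d hd)⟩,
      hr.man_inj, hr.woman_inj, ?_⟩
    rintro d ⟨hd, hdc⟩
    exact hr.dom d ⟨hd, fun h => (congrArg X.mkey (hdc h)).le⟩
  obtain ⟨d, hd, hdm⟩ := htZ.exists_man_eq hrZ hct
  exact hrm d hd (hdm.trans hcm)

end ContractMarket

namespace SMInst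

/-- If no path of length one or three augments `M` towards the matching `N`, then `M` has at
least two thirds of the size of `N`. -/
theorem two_mul_card_le_three_mul_card {α β : Type} {M N : Finset (α × β)}
    (hN₁ : ∀ p ∈ N, ∀ q ∈ N, p.1 = q.1 → p = q)
    (hN₂ : ∀ p ∈ N, ∀ q ∈ N, p.2 = q.2 → p = q)
    (hone : ∀ m w, (m, w) ∈ N → mSingle M m → ¬ wSingle M w)
    (hthree : ∀ m₀ w₁ m₁ w₀, (m₀, w₁) ∈ N → (m₁, w₁) ∈ M → (m₁, w₀) ∈ N →
      mSingle M m₀ → ¬ wSingle M w₀) :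
    2 * N.card ≤ 3 * M.card := by
  classical
  have fst_le : ∀ A ⊆ N, ∀ B : Finset (α × β), (∀ p ∈ A, ∃ w, (p.1, w) ∈ B) →
      A.card ≤ B.card := by
    intro A hA B h
    rw [← Finset.card_image_of_injOn (s := A) (f := Prod.fst)
      fun p hp q hq e => hN₁ p (hA hp) q (hA hq) e]
    refine (Finset.card_le_card ?_).trans (Finset.card_image_le (s := B) (f := Prod.fst))
    intro m hm
    obtain ⟨p, hp, rfl⟩ := Finset.mem_image.1 hm
    obtain ⟨w, hw⟩ := h p hp
    exact Finset.mem_image.2 ⟨_, hw, rfl⟩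
  have snd_le : ∀ A ⊆ N, ∀ B : Finset (α × β), (∀ p ∈ A, ∃ m, (m, p.2) ∈ B) →
      A.card ≤ B.card := by
    intro A hA B h
    rw [← Finset.card_image_of_injOn (s := A) (f := Prod.snd)
      fun p hp q hq e => hN₂ p (hA hp) q (hA hq) e]
    refine (Finset.card_le_card ?_).trans (Finset.card_image_le (s := B) (f := Prod.snd))
    intro m hm
    obtain ⟨p, hp, rfl⟩ := Finset.mem_image.1 hm
    obtain ⟨w, hw⟩ := h p hp
    exact Finset.mem_image.2 ⟨_, hw, rfl⟩
  set Y := M.filter fun p => ∃ m, (m, p.2) ∈ N ∧ mSingle M m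
  have h1 : (N.filter fun p => mSingle M p.1).card ≤ Y.card := by
    refine snd_le _ (Finset.filter_subset _ _) _ fun p hp => ?_
    rw [Finset.mem_filter] at hp
    have := hone p.1 p.2 hp.1 hp.2
    simp only [wSingle, not_forall, not_not] at this
    obtain ⟨m, hm⟩ := this
    exact ⟨m, Finset.mem_filter.2 ⟨hm, p.1, hp.1, hp.2⟩⟩
  have h2 : (N.filter fun p => wSingle M p.2).card ≤ (M \ Y).card := by
    refine fst_le _ (Finset.filter_subset _ _) _ fun p hp => ?_
    rw [Finset.mem_filter] at hp
    have : ¬ mSingle M p.1 := fun h => hone p.1 p.2 hp.1 h hp.2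
    simp only [mSingle, not_forall, not_not] at this
    obtain ⟨w, hw⟩ := this
    refine ⟨w, Finset.mem_sdiff.2 ⟨hw, fun h => ?_⟩⟩
    obtain ⟨-, m, hmN, hmM⟩ := Finset.mem_filter.1 h
    exact hthree m w p.1 p.2 hmN hw hp.1 hmM hp.2
  have h3 : (N.filter fun p => ¬ mSingle M p.1).card ≤ M.card := by
    refine fst_le _ (Finset.filter_subset _ _) _ fun p hp => ?_
    simpa [mSingle] using (Finset.mem_filter.1 hp).2
  have h4 : (N.filter fun p => ¬ wSingle M p.2).card ≤ M.card := by
    refine snd_le _ (Finset.filter_subset _ _) _ fun p hp => ?_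
    simpa [wSingle] using (Finset.mem_filter.1 hp).2
  have h5 := Finset.card_filter_add_card_filter_not (s := N) fun p => mSingle M p.1
  have h6 := Finset.card_filter_add_card_filter_not (s := N) fun p => wSingle M p.2
  have h7 := Finset.card_sdiff_add_card_eq_card (show Y ⊆ M from Finset.filter_subset _ _)
  omega

variable {n : ℕ}

/-- Every mutually acceptable pair yields an ordinary and a promoted contract
(with last component `false` and `true`).  Women prefer ordinary contracts to promoted ones;
men prefer promoted contracts within each tie. -/
def market (I : SMInst (Fin n) (Fin n)) :
    ContractMarket (Fin n × Fin n × Bool) (Fin n) (Fin n)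
      (ℕ ×ₗ (Bool ×ₗ Fin n)) (Bool ×ₗ (ℕ ×ₗ Fin n)) where
  man c := c.1
  woman c := c.2.1
  acc := {c | I.mAcc c.1 c.2.1 ∧ I.wAcc c.2.1 c.1}
  mkey c := toLex ((I.mpref c.1 c.2.1).getD 0, toLex (!c.2.2, c.2.1))
  wkey c := toLex (c.2.2, toLex ((I.wpref c.2.1 c.1).getD 0, c.1))
  mkey_inj := by
    rintro ⟨m, w, b⟩ ⟨m', w', b'⟩ h h'
    simp_all
  wkey_inj := by
    rintro ⟨m, w, b⟩ ⟨m', w', b'⟩ h h'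
    simp_all

/-- The man-woman pairs of a set of contracts. -/
noncomputable def pairs (s : Set (Fin n × Fin n × Bool)) : Finset (Fin n × Fin n) :=
  (Set.toFinite ((fun c : Fin n × Fin n × Bool => (c.1, c.2.1)) '' s)).toFinset

theorem mem_pairs {s : Set (Fin n × Fin n × Bool)} {m w : Fin n} :
    (m, w) ∈ pairs s ↔ ∃ b, (m, w, b) ∈ s := by
  simp [pairs]

variable {I : SMInst (Fin n) (Fin n)} {s : Set (Fin n × Fin n × Bool)}

theorem mkey_lt_of_mPref {m w w' : Fin n} (h : I.mPref m w w') (b b' : Bool) :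
    I.market.mkey (m, w, b) < I.market.mkey (m, w', b') := by
  obtain ⟨r, r', h1, h2, hlt⟩ := h
  simp [market, Prod.Lex.toLex_lt_toLex, h1, h2, hlt]

theorem wkey_lt_of_wPref {m m' w : Fin n} (h : I.wPref w m m') (b : Bool) :
    I.market.wkey (m, w, false) < I.market.wkey (m', w, b) := by
  obtain ⟨r, r', h1, h2, hlt⟩ := h
  cases b <;> simp [market, Prod.Lex.toLex_lt_toLex, h1, h2, hlt]

theorem isMatching_pairs (hs : I.market.Stable s) : I.IsMatching (pairs s) := by
  refine ⟨?_, ?_, ?_⟩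
  · rintro ⟨m, w⟩ hp
    obtain ⟨b, hb⟩ := mem_pairs.1 hp
    exact hs.subset_acc hb
  · rintro ⟨m, w⟩ hp ⟨m', w'⟩ hq h
    obtain ⟨b, hb⟩ := mem_pairs.1 hp
    obtain ⟨b', hb'⟩ := mem_pairs.1 hq
    have := hs.man_inj _ hb _ hb' h
    simp_all
  · rintro ⟨m, w⟩ hp ⟨m', w'⟩ hq h
    obtain ⟨b, hb⟩ := mem_pairs.1 hp
    obtain ⟨b', hb'⟩ := mem_pairs.1 hq
    have := hs.woman_inj _ hb _ hb' h
    simp_all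

theorem isStable_pairs (hs : I.market.Stable s) : I.IsStable (pairs s) := by
  refine ⟨isMatching_pairs hs, ?_⟩
  rintro m w ⟨hm, hw, hmb, hwb⟩
  rcases hs.dom (m, w, false) ⟨hm, hw⟩ with ⟨⟨m', w', b⟩, he, hem, hek⟩ |
    ⟨⟨m', w', b⟩, he, hew, hek⟩
  · obtain rfl : m' = m := hem
    rcases hmb with hmb | ⟨w₁, hw₁, hpref⟩
    · exact hmb _ (mem_pairs.2 ⟨b, he⟩)
    · obtain ⟨b₁, hb₁⟩ := mem_pairs.1 hw₁
      cases hs.man_inj _ he _ hb₁ rfl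
      exact absurd hek (not_le.2 (mkey_lt_of_mPref hpref _ _))
  · obtain rfl : w' = w := hew
    rcases hwb with hwb | ⟨m₁, hm₁, hpref⟩
    · exact hwb _ (mem_pairs.2 ⟨b, he⟩)
    · obtain ⟨b₁, hb₁⟩ := mem_pairs.1 hm₁
      cases hs.woman_inj _ he _ hb₁ rfl
      exact absurd hek (not_le.2 (wkey_lt_of_wPref hpref _))

theorem two_mul_card_le_of_isStable (hI : I.OneTM) (hs : I.market.Stable s)
    {N : Finset (Fin n × Fin n)} (hN : I.IsStable N) :
    2 * N.card ≤ 3 * (pairs s).card := by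
  obtain ⟨⟨hacc, hN₁, hN₂⟩, hblock⟩ := hN
  refine two_mul_card_le_three_mul_card hN₁ hN₂ ?_ ?_
  · intro m w h hm hw
    exact (isStable_pairs hs).2 m w ⟨(hacc _ h).1, (hacc _ h).2, Or.inl hm, Or.inl hw⟩
  · intro m₀ w₁ m₁ w₀ h01 h11 h10 hm₀ hw₀
    obtain ⟨b, hb⟩ := mem_pairs.1 h11
    have hfalse : b = false ∧ I.wPref w₁ m₁ m₀ := by
      rcases hs.dom (m₀, w₁, false) (hacc _ h01) with ⟨⟨m', w', b'⟩, he, hem, -⟩ |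
        ⟨⟨m', w', b'⟩, he, hew, hek⟩
      · obtain rfl : m' = m₀ := hem
        exact absurd (mem_pairs.2 ⟨b', he⟩) (hm₀ w')
      · cases hs.woman_inj _ he _ hb hew
        have ha₀ := (hacc _ h01).2
        have ha₁ := (hs.subset_acc hb).2
        have hne : m₁ ≠ m₀ := by
          rintro rfl
          exact hm₀ _ h11
        obtain ⟨r₀, hr₀⟩ := Option.isSome_iff_exists.1 ha₀
        obtain ⟨r₁, hr₁⟩ := Option.isSome_iff_exists.1 ha₁
        dsimp only at hr₀ hr₁
        have hr : r₁ ≠ r₀ := fun h => hne (hI w₁ m₁ m₀ (by rw [hr₀, hr₁, h]) ha₁)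
        simp only [market, Prod.Lex.toLex_le_toLex, hr₀, hr₁, Option.getD_some, hr,
          false_and, or_false] at hek
        rcases hek with hlt | ⟨rfl, hlt⟩
        · exact absurd hlt (by cases b <;> decide)
        · exact ⟨rfl, r₁, r₀, hr₁, hr₀, hlt⟩
    obtain ⟨rfl, hwpref⟩ := hfalse
    have hmpref : I.mPref m₁ w₁ w₀ := by
      rcases hs.dom (m₁, w₀, true) (hacc _ h10) with ⟨⟨m', w', b'⟩, he, hem, hek⟩ |
        ⟨⟨m', w', b'⟩, he, hew, -⟩
      · cases hs.man_inj _ he _ hb hem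
        obtain ⟨r₀, hr₀⟩ := Option.isSome_iff_exists.1 (hacc _ h10).1
        obtain ⟨r₁, hr₁⟩ := Option.isSome_iff_exists.1 (hs.subset_acc hb).1
        dsimp only at hr₀ hr₁
        simp only [market, Prod.Lex.toLex_le_toLex, hr₀, hr₁, Option.getD_some] at hek
        rcases hek with hlt | ⟨rfl, hlt⟩
        · exact ⟨r₁, r₀, hr₁, hr₀, hlt⟩
        · rcases hlt with h | ⟨h, -⟩ <;> exact absurd h (by decide)
      · obtain rfl : w' = w₀ := hew
        exact absurd (mem_pairs.2 ⟨b', he⟩) (hw₀ m')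
    exact hblock m₁ w₁ ⟨(hs.subset_acc hb).1, (hs.subset_acc hb).2,
      Or.inr ⟨w₀, h10, hmpref⟩, Or.inr ⟨m₀, h01, hwpref⟩⟩

/-- A single man cannot profitably falsify his list. -/
theorem not_mPrefMatching_pairs {I' : SMInst (Fin n) (Fin n)}
    {t : Set (Fin n × Fin n × Bool)} {m : Fin n} (hs : I.market.ManOptimal s)
    (ht : I'.market.Stable t) (hdiff : I.mDiffOnly I' m) :
    ¬ I.mPrefMatching m (pairs t) (pairs s) := by
  rintro ⟨w, hw, haccw, hbetter⟩
  obtain ⟨b, hb⟩ := mem_pairs.1 hw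
  have hwacc : I.wAcc w m := by
    have := (ht.subset_acc hb).2
    rwa [wAcc, ← hdiff.1] at this
  obtain ⟨⟨m', w', b'⟩, he, hem, hek⟩ := hs.exists_mkey_le (X := I.market) (Y := I'.market) m rfl rfl
    (by simp [market, hdiff.1])
    (fun c hc => by
      have : I.mpref c.1 = I'.mpref c.1 := hdiff.2 c.1 hc
      simp [market, mAcc, wAcc, hdiff.1, this])
    (fun c hc => by
      have : I.mpref c.1 = I'.mpref c.1 := hdiff.2 c.1 hc
      simp [market, this])
    ht hb ⟨haccw, hwacc⟩ rfl
  obtain rfl : m' = m := hem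
  rcases hbetter with hsingle | ⟨w₁, hw₁, hpref⟩
  · exact hsingle w' (mem_pairs.2 ⟨b', he⟩)
  · obtain ⟨b₁, hb₁⟩ := mem_pairs.1 hw₁
    cases hs.1.man_inj _ he _ hb₁ rfl
    exact absurd hek (not_le.2 (mkey_lt_of_mPref hpref _ _))

end SMInst

/-- MAX SMTI-1TM admits a man-strategy-proof 1.5-approximate-stable mechanism. -/
theorem man_sp_one_point_five_approx_stable_mechanism_SMTI1TM :
    ∃ S : ∀ n : ℕ, SMInst (Fin n) (Fin n) → Finset (Fin n × Fin n),
      (∀ (n : ℕ) (I : SMInst (Fin n) (Fin n)), I.OneTM →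
          I.IsStable (S n I) ∧
          ∀ Mopt : Finset (Fin n × Fin n), I.IsStable Mopt →
            2 * Mopt.card ≤ 3 * (S n I).card) ∧
      ¬ ∃ (n : ℕ) (I I' : SMInst (Fin n) (Fin n)) (m : Fin n),
          I.OneTM ∧ I'.OneTM ∧ SMInst.mDiffOnly I I' m ∧
          I.mPrefMatching m (S n I') (S n I) := by
  choose S hS using fun (n : ℕ) (I : SMInst (Fin n) (Fin n)) => I.market.exists_manOptimal
  refine ⟨fun n I => SMInst.pairs (S n I), fun n I hI =>
    ⟨SMInst.isStable_pairs (hS n I).1, fun N hN =>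
      SMInst.two_mul_card_le_of_isStable hI (hS n I).1 hN⟩, ?_⟩
  rintro ⟨n, I, I', m, -, -, hdiff, hpref⟩
  exact SMInst.not_mPrefMatching_pairs (hS n I) (hS n I').1 hdiff hpref
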